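/- arXiv:0904.3624 — 3 statements merged into one kernel-verified Lean document; each statement's English description precedes it below -/
import Mathlib

section
/- Let R → B be a ring homomorphism, I ⊂ B an ideal generated by a regular sequence x₁,…,xᵣ, such that B/I is flat as an R-module. Then B/Iⁿ is flat as an R-module for every n ≥ 0. -/
/-- An extension of flat modules is flat. -/
theorem flat_of_extension {R M₁ M₂ M₃ : Type*} [CommRing R]
    [AddCommGroup M₁] [AddCommGroup M₂] [AddCommGroup M₃]
    [Module R M₁] [Module R M₂] [Module R M₃]
    (f : M₁ →ₗ[R] M₂) (g : M₂ →ₗ[R] M₃) (hf : Function.Injective f)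
    (hg : Function.Surjective g) (hfg : Function.Exact f g)
    [Module.Flat R M₁] [Module.Flat R M₃] : Module.Flat R M₂ := by
  rw [Module.Flat.iff_rTensor_injective']
  intro I
  rw [injective_iff_map_eq_zero]
  intro z hz
  have h1 : g.lTensor I z = 0 := by
    apply Module.Flat.iff_rTensor_injective'.mp ‹Module.Flat R M₃› I
    rw [map_zero, ← LinearMap.comp_apply, LinearMap.rTensor_comp_lTensor,
      ← LinearMap.lTensor_comp_rTensor, LinearMap.comp_apply, hz, map_zero]
  obtain ⟨w, rfl⟩ := (lTensor_exact I hfg hg z).mp h1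
  have h2 : I.subtype.rTensor M₁ w = 0 := by
    apply Module.Flat.lTensor_preserves_injective_linearMap (M := R) f hf
    rw [map_zero, ← LinearMap.comp_apply, LinearMap.lTensor_comp_rTensor,
      ← LinearMap.rTensor_comp_lTensor, LinearMap.comp_apply, hz]
  have h3 : w = 0 := by
    apply Module.Flat.iff_rTensor_injective'.mp ‹Module.Flat R M₁› I
    rw [h2, map_zero]
  rw [h3, map_zero]

/-- Flatness of `B/K` from that of `B/(K : y)` and `B/(K + (y))`. -/
theorem flat_quotient_step (R : Type*) {B : Type*} [CommRing R] [CommRing B] [Algebra R B]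
    (K K' : Ideal B) (y : B) (h : ∀ a, a ∈ K' ↔ y * a ∈ K)
    (h1 : Module.Flat R (B ⧸ K')) (h2 : Module.Flat R (B ⧸ (K ⊔ Ideal.span {y}))) :
    Module.Flat R (B ⧸ K) := by
  let f : (B ⧸ K') →ₗ[B] (B ⧸ K) :=
    Submodule.mapQ K' K (LinearMap.mulLeft B y) (fun a ha => (h a).mp ha)
  let g : (B ⧸ K) →ₗ[B] (B ⧸ (K ⊔ Ideal.span {y})) := Submodule.factor le_sup_left
  have hf : Function.Injective f := by
    rw [injective_iff_map_eq_zero]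
    intro z hz
    obtain ⟨a, rfl⟩ := Submodule.Quotient.mk_surjective _ z
    rw [Submodule.Quotient.mk_eq_zero]
    exact (h a).mpr ((Submodule.Quotient.mk_eq_zero K).mp hz)
  have hg : Function.Surjective g := Submodule.factor_surjective _
  have hfg : Function.Exact f g := by
    intro z
    obtain ⟨a, rfl⟩ := Submodule.Quotient.mk_surjective _ z
    constructor
    · intro hz
      have hz' : a ∈ K ⊔ Ideal.span {y} := by
        rw [← Submodule.Quotient.mk_eq_zero]
        exact hz
      obtain ⟨k, hk, b, hb, rfl⟩ := Submodule.mem_sup.mp hz'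
      obtain ⟨c, rfl⟩ := Ideal.mem_span_singleton'.mp hb
      refine ⟨Submodule.Quotient.mk c, ?_⟩
      refine (Submodule.Quotient.eq K).mpr ?_
      rw [LinearMap.mulLeft_apply]
      have : y * c - (k + c * y) = - k := by ring
      rw [this]
      exact K.neg_mem hk
    · rintro ⟨w, hw⟩
      obtain ⟨c, rfl⟩ := Submodule.Quotient.mk_surjective _ w
      rw [← hw]
      refine (Submodule.Quotient.mk_eq_zero (K ⊔ Ideal.span {y})).mpr ?_
      exact Ideal.mem_sup_right (Ideal.mul_mem_right _ _ (Ideal.mem_span_singleton_self y))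
  exact flat_of_extension (f.restrictScalars R) (g.restrictScalars R) hf hg hfg

/-- A predicate on ideals closed under the extensions `B/(K:y) → B/K → B/(K+(y))`. -/
def ExtClosed {B : Type*} [CommRing B] (P : Ideal B → Prop) : Prop :=
  P ⊤ ∧ ∀ (K K' : Ideal B) (y : B), (∀ a, a ∈ K' ↔ y * a ∈ K) → P K' →
    P (K ⊔ Ideal.span {y}) → P K

theorem ExtClosed.reg {B : Type*} [CommRing B] {P : Ideal B → Prop} (hP : ExtClosed P) (x : B) :
    ExtClosed (fun K => (∀ a, x * a ∈ K → a ∈ K) ∧ P (K ⊔ Ideal.span {x})) := by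
  refine ⟨⟨fun _ _ => trivial, by rw [top_sup_eq]; exact hP.1⟩, ?_⟩
  rintro K K' y h ⟨r1, p1⟩ ⟨r2, p2⟩
  constructor
  · intro a ha
    obtain ⟨k, hk, b, hb, rfl⟩ := Submodule.mem_sup.mp (r2 a (Ideal.mem_sup_left ha))
    obtain ⟨c, rfl⟩ := Ideal.mem_span_singleton'.mp hb
    refine K.add_mem hk ?_
    rw [mul_comm]
    refine (h c).mp (r1 c ((h _).mpr ?_))
    have : y * (x * c) = x * (k + c * y) - x * k := by ring
    rw [this]
    exact K.sub_mem ha (K.mul_mem_left _ hk)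
  · refine hP.2 _ (K' ⊔ Ideal.span {x}) y ?_ p1 (by rwa [sup_right_comm])
    intro a
    constructor
    · intro ha
      obtain ⟨k, hk, b, hb, rfl⟩ := Submodule.mem_sup.mp ha
      rw [mul_add]
      exact add_mem (Ideal.mem_sup_left ((h k).mp hk))
        (Ideal.mem_sup_right (Ideal.mul_mem_left _ _ hb))
    · intro ha
      obtain ⟨k, hk, b, hb, e⟩ := Submodule.mem_sup.mp ha
      obtain ⟨c, rfl⟩ := Ideal.mem_span_singleton'.mp hb
      have hc : c ∈ K ⊔ Ideal.span {y} := by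
        apply r2
        have : x * c = a * y - k := by linear_combination e
        rw [this]
        exact sub_mem (Ideal.mem_sup_right (Ideal.mul_mem_left _ _
          (Ideal.mem_span_singleton_self y))) (Ideal.mem_sup_left hk)
      obtain ⟨k', hk', b', hb', rfl⟩ := Submodule.mem_sup.mp hc
      obtain ⟨d, rfl⟩ := Ideal.mem_span_singleton'.mp hb'
      have : a = (a - d * x) + d * x := by ring
      rw [this]
      refine add_mem (Ideal.mem_sup_left ((h _).mpr ?_))
        (Ideal.mem_sup_right (Ideal.mul_mem_left _ _ (Ideal.mem_span_singleton_self x)))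
      have : y * (a - d * x) = k + x * k' := by linear_combination -e
      rw [this]
      exact add_mem hk (K.mul_mem_left _ hk')

theorem sup_span_pow_succ_le {B : Type*} [CommRing B] (J : Ideal B) (x : B) (n : ℕ) :
    (J ⊔ Ideal.span {x}) ^ (n + 1) ≤
      J ^ (n + 1) ⊔ Ideal.span {x} * (J ⊔ Ideal.span {x}) ^ n := by
  induction n with
  | zero => simp
  | succ n ih =>
    rw [pow_succ' _ (n + 1), Ideal.sup_mul]
    refine sup_le ?_ le_sup_right
    refine (Ideal.mul_mono_right ih).trans ?_
    rw [Ideal.mul_sup, ← pow_succ']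
    refine sup_le_sup le_rfl ?_
    rw [mul_left_comm, pow_succ' _ n]
    exact Ideal.mul_mono_right (Ideal.mul_mono_left le_sup_left)

/-- The inductive step: adjoining one element to the sequence. -/
theorem ext_step {B : Type*} [CommRing B] {P : Ideal B → Prop} (hP : ExtClosed P) (J : Ideal B)
    (x : B) (h : ∀ n, (∀ a, x * a ∈ J ^ n → a ∈ J ^ n) ∧ P (J ^ n ⊔ Ideal.span {x})) (n : ℕ) :
    P ((J ⊔ Ideal.span {x}) ^ n) := by
  induction n with
  | zero => rw [pow_zero, Ideal.one_eq_top]; exact hP.1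
  | succ n ih =>
    refine hP.2 _ _ x ?_ ih ?_
    · intro a
      constructor
      · intro ha
        rw [pow_succ']
        exact Ideal.mul_mem_mul (Ideal.mem_sup_right (Ideal.mem_span_singleton_self x)) ha
      · intro ha
        obtain ⟨d, hd, e, he, hde⟩ := Submodule.mem_sup.mp (sup_span_pow_succ_le J x n ha)
        obtain ⟨c, hc, rfl⟩ := Ideal.mem_span_singleton_mul.mp he
        have h1 : a - c ∈ J ^ (n + 1) := by
          apply (h (n + 1)).1
          have : x * (a - c) = d := by linear_combination -hde
          rwa [this]
        have h2 : a - c ∈ (J ⊔ Ideal.span {x}) ^ n :=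
          Ideal.pow_right_mono le_sup_left n (Ideal.pow_le_pow_right n.le_succ h1)
        have := add_mem h2 hc
        rwa [sub_add_cancel] at this
    · have : (J ⊔ Ideal.span {x}) ^ (n + 1) ⊔ Ideal.span {x} = J ^ (n + 1) ⊔ Ideal.span {x} := by
        apply le_antisymm
        · exact sup_le ((sup_span_pow_succ_le J x n).trans
            (sup_le_sup le_rfl Ideal.mul_le_left)) le_sup_right
        · exact sup_le_sup (Ideal.pow_right_mono le_sup_left _) le_rfl
      rw [this]
      exact (h (n + 1)).2

theorem ext_list {B : Type*} [CommRing B] (rs : List B)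
    (hrs : RingTheory.Sequence.IsWeaklyRegular B rs) (i : ℕ) (hi : i ≤ rs.length) :
    ∀ {P : Ideal B → Prop}, ExtClosed P → P (Ideal.ofList (rs.take i)) →
      ∀ n, P (Ideal.ofList (rs.take i) ^ n) := by
  induction i with
  | zero =>
    intro P hP h n
    rcases n with _ | n
    · rw [pow_zero, Ideal.one_eq_top]; exact hP.1
    · rw [List.take_zero, Ideal.ofList_nil] at h ⊢
      rwa [← Ideal.zero_eq_bot, zero_pow n.succ_ne_zero]
  | succ i ih =>
    intro P hP h n
    have e : Ideal.ofList (rs.take (i + 1)) =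
        Ideal.ofList (rs.take i) ⊔ Ideal.span {rs[i]} := by
      rw [← List.take_concat_get' rs i hi, Ideal.ofList_append, Ideal.ofList_singleton]
    rw [e] at h ⊢
    refine ext_step hP _ _ (ih (by omega) (hP.reg rs[i]) ⟨?_, h⟩) n
    intro a ha
    have hr := hrs.regular_mod_prev i hi
    have e2 : (Ideal.ofList (rs.take i) • ⊤ : Submodule B B) = Ideal.ofList (rs.take i) := by
      simp
    rw [e2] at hr
    rw [← Submodule.Quotient.mk_eq_zero (Ideal.ofList (rs.take i))]
    apply hr
    simp only [smul_zero]
    rw [← Submodule.Quotient.mk_smul]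
    exact (Submodule.Quotient.mk_eq_zero _).mpr ha


/-- Let `R → B` be a ring homomorphism and `I ⊂ B` an ideal generated by a regular
sequence `x₁, …, xᵣ` such that `B/I` is flat as an `R`-module.  Then `B/Iⁿ` is flat as an
`R`-module for every `n ≥ 0`. -/
theorem flat_quotient_pow_of_flat_quotient
    (R B : Type*) [CommRing R] [CommRing B] [Algebra R B]
    (r : ℕ) (x : Fin r → B)
    (hreg : RingTheory.Sequence.IsRegular B (List.ofFn x))
    (I : Ideal B) (hI : I = Ideal.span (Set.range x))
    [Module.Flat R (B ⧸ I)] (n : ℕ) :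
    Module.Flat R (B ⧸ I ^ n) := by
  have hl : Ideal.ofList ((List.ofFn x).take (List.ofFn x).length) = I := by
    rw [List.take_length, hI]
    refine congrArg Ideal.span (Set.ext fun b => ?_)
    exact List.mem_ofFn.trans Iff.rfl
  have := ext_list (List.ofFn x) hreg.toIsWeaklyRegular _ le_rfl
    (P := fun K => Module.Flat R (B ⧸ K))
    ⟨by
      have : Subsingleton (B ⧸ (⊤ : Ideal B)) := Ideal.Quotient.subsingleton_iff.mpr rfl
      infer_instance, fun K K' y => flat_quotient_step R K K' y⟩
  rw [hl] at this
  exact this inferInstance n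
end

section
/- Let R → B be a ring homomorphism, I ⊂ B an ideal generated by a regular sequence with B/I flat over R, and R → R' any ring homomorphism; set B' = R' ⊗_R B and I' = I·B'. Then for every n ≥ 0, the natural map Iⁿ ⊗_R R' → B' is injective with image (I')ⁿ; consequently the Rees algebra satisfies (⊕ₙ Iⁿ) ⊗_R R' ≅ ⊕ₙ (I')ⁿ as graded B'-algebras. -/
open TensorProduct

/-- `J ^ n / J ^ (n + 1)` is finite free over `B / J`, in elementary terms. -/
def QuasiFreeAt {B : Type*} [CommRing B] (J : Ideal B) (n : ℕ) : Prop :=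
  ∃ (k : ℕ) (m : Fin k → B), Ideal.span (Set.range m) = J ^ n ∧
    ∀ c : Fin k → B, ∑ i, c i * m i ∈ J ^ (n + 1) → ∀ i, c i ∈ J

lemma quasiFreeAt_zero {B : Type*} [CommRing B] (J : Ideal B) : QuasiFreeAt J 0 := by
  refine ⟨1, fun _ => 1, ?_, ?_⟩
  · simp
  · intro c hc i
    have : i = 0 := Subsingleton.elim _ _
    subst this
    simpa using hc

lemma mem_pow_of_mul_mem {B : Type*} [CommRing B] (J : Ideal B) (x : B)
    (hx : ∀ b, x * b ∈ J → b ∈ J) (hJ : ∀ n, QuasiFreeAt J n) (n : ℕ) :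
    ∀ b, x * b ∈ J ^ n → b ∈ J ^ n := by
  induction n with
  | zero => intro b _; simp
  | succ n ih =>
    intro b hb
    have h1 := ih b (Ideal.pow_le_pow_right (Nat.le_succ n) hb)
    obtain ⟨k, m, hm, hq⟩ := hJ n
    have h2 := h1
    rw [← hm, Ideal.mem_span_range_iff_exists_fun] at h2
    obtain ⟨c, rfl⟩ := h2
    have h3 := hq (fun i => x * c i) (by simpa [Finset.mul_sum, mul_assoc] using hb)
    refine Ideal.sum_mem _ fun i _ => ?_
    rw [pow_succ']
    refine Ideal.mul_mem_mul (hx _ (h3 i)) ?_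
    rw [← hm]
    exact Ideal.subset_span ⟨i, rfl⟩

lemma sup_span_pow_succ {B : Type*} [CommRing B] (J : Ideal B) (x : B) (n : ℕ) :
    (J ⊔ Ideal.span {x}) ^ (n + 1) =
      J ^ (n + 1) ⊔ Ideal.span {x} * (J ⊔ Ideal.span {x}) ^ n := by
  apply le_antisymm
  · induction n with
    | zero => simp
    | succ n ih =>
      rw [pow_succ']
      nth_rewrite 1 [Ideal.sup_mul]
      refine sup_le ?_ le_sup_right
      refine (Ideal.mul_mono_right ih).trans ?_
      rw [Ideal.mul_sup]
      refine sup_le ?_ ?_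
      · rw [← pow_succ']; exact le_sup_left
      · refine le_trans ?_ le_sup_right
        rw [mul_left_comm]
        refine Ideal.mul_mono_right ?_
        rw [pow_succ']
        exact Ideal.mul_mono_left le_sup_left
  · refine sup_le (Ideal.pow_right_mono le_sup_left _) ?_
    rw [pow_succ']
    exact Ideal.mul_mono_left le_sup_right

lemma quasiFreeAt_sup {B : Type*} [CommRing B] (J : Ideal B) (x : B)
    (hx : ∀ b, x * b ∈ J → b ∈ J) (hJ : ∀ n, QuasiFreeAt J n) (n : ℕ) :
    QuasiFreeAt (J ⊔ Ideal.span {x}) n := by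
  have key := mem_pow_of_mul_mem J x hx hJ
  have hle : J ≤ J ⊔ Ideal.span {x} := le_sup_left
  have hxI : x ∈ J ⊔ Ideal.span {x} :=
    (le_sup_right : Ideal.span {x} ≤ J ⊔ Ideal.span {x}) (Ideal.mem_span_singleton_self x)
  have hpow := sup_span_pow_succ J x
  generalize hIdef : J ⊔ Ideal.span {x} = I at *
  induction n with
  | zero => exact quasiFreeAt_zero _
  | succ n ih =>
    obtain ⟨k, m, hm, hq⟩ := hJ (n + 1)
    obtain ⟨l, m', hm', hq'⟩ := ih
    refine ⟨k + l, Fin.append m (fun j => x * m' j), ?_, ?_⟩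
    · rw [hpow n, ← hm, ← hm', Ideal.span_mul_span', ← Ideal.span_union]
      congr 1
      ext b
      simp only [Set.mem_range, Set.mem_union, Set.singleton_mul, Set.mem_image,
        exists_exists_eq_and]
      constructor
      · rintro ⟨i, rfl⟩
        induction i using Fin.addCases with
        | left i => left; exact ⟨i, by simp⟩
        | right i => right; exact ⟨i, by simp⟩
      · rintro (⟨i, rfl⟩ | ⟨i, rfl⟩)
        · exact ⟨Fin.castAdd l i, by simp⟩
        · exact ⟨Fin.natAdd k i, by simp⟩
    · intro c hc
      rw [Fin.sum_univ_add] at hc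
      simp only [Fin.append_left, Fin.append_right] at hc
      rw [hpow (n + 1), Submodule.mem_sup] at hc
      obtain ⟨p, hp, q, hqq, hpq⟩ := hc
      rw [Ideal.mem_span_singleton_mul] at hqq
      obtain ⟨e, he, rfl⟩ := hqq
      set S := ∑ i, c (Fin.castAdd l i) * m i with hS
      set T := ∑ j, c (Fin.natAdd k j) * m' j with hT
      have hT' : ∑ j, c (Fin.natAdd k j) * (x * m' j) = x * T := by
        rw [hT, Finset.mul_sum]
        exact Finset.sum_congr rfl fun _ _ => by ring
      rw [hT'] at hpq
      have hSmem : S ∈ J ^ (n + 1) := by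
        rw [← hm]
        exact Ideal.sum_mem _ fun i _ => Ideal.mul_mem_left _ _ (Ideal.subset_span ⟨i, rfl⟩)
      have hp' : p ∈ J ^ (n + 1) := Ideal.pow_le_pow_right (Nat.le_succ _) hp
      have hh : T - e ∈ J ^ (n + 1) := by
        apply key
        have : x * (T - e) = p - S := by linear_combination -hpq
        rw [this]
        exact Ideal.sub_mem _ hp' hSmem
      have hTI : T ∈ I ^ (n + 1) := by
        have := Ideal.add_mem _ (Ideal.pow_right_mono hle _ hh) he
        simpa using this
      have hd := hq' _ hTI
      have hh2 := hh
      rw [← hm, Ideal.mem_span_range_iff_exists_fun] at hh2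
      obtain ⟨h, hh2⟩ := hh2
      have hcx := hq (fun i => c (Fin.castAdd l i) + x * h i) (by
        have : ∑ i, (c (Fin.castAdd l i) + x * h i) * m i = p := by
          have h3 : ∑ i, (c (Fin.castAdd l i) + x * h i) * m i = S + x * ∑ i, h i * m i := by
            rw [hS, Finset.mul_sum, ← Finset.sum_add_distrib]
            exact Finset.sum_congr rfl fun _ _ => by ring
          rw [h3, hh2]
          linear_combination -hpq
        rw [this]
        exact hp)
      intro i
      induction i using Fin.addCases with
      | left i =>
        have := Ideal.sub_mem _ (hle (hcx i)) (Ideal.mul_mem_right (h i) _ hxI)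
        simpa using this
      | right j => exact hd j

lemma quasiFreeAt_of_isWeaklyRegular {B : Type*} [CommRing B] (l : List B)
    (h : RingTheory.Sequence.IsWeaklyRegular B l) (n : ℕ) : QuasiFreeAt (Ideal.ofList l) n := by
  induction l using List.reverseRecOn generalizing n with
  | nil =>
    cases n with
    | zero => exact quasiFreeAt_zero _
    | succ n =>
      refine ⟨0, Fin.elim0, ?_, fun _ _ i => i.elim0⟩
      simp [Ideal.ofList_nil]
  | append_singleton l x ih =>
    rw [RingTheory.Sequence.isWeaklyRegular_append_iff,
      RingTheory.Sequence.isWeaklyRegular_singleton_iff] at h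
    rw [Ideal.ofList_append, Ideal.ofList_singleton]
    refine quasiFreeAt_sup _ _ ?_ (ih h.1) n
    intro b hb
    have := (isSMulRegular_quotient_iff_mem_of_smul_mem _ _).mp h.2 b
    simpa [hb] using this

lemma flat_pow_quotient (R : Type*) {B : Type*} [CommRing R] [CommRing B] [Algebra R B]
    (I : Ideal B) [Module.Flat R (B ⧸ I)] (n : ℕ) (h : QuasiFreeAt I n) :
    Module.Flat R (↥(I ^ n) ⧸ Submodule.comap (Submodule.subtype (I ^ n)) (I ^ (n + 1))) := by
  obtain ⟨k, m, hm, hq⟩ := h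
  have hmem : ∀ i, m i ∈ I ^ n := fun i => by rw [← hm]; exact Ideal.subset_span ⟨i, rfl⟩
  let N := Submodule.comap (Submodule.subtype (I ^ n)) (I ^ (n + 1))
  let g : (Fin k → B) →ₗ[B] ↥(I ^ n) := Fintype.linearCombination B (fun i => ⟨m i, hmem i⟩)
  have hg : ∀ c, ((g c : ↥(I ^ n)) : B) = ∑ i, c i * m i := fun c => by
    simp [g, Fintype.linearCombination_apply]
  let f : (Fin k → B) →ₗ[B] (↥(I ^ n) ⧸ N) := N.mkQ ∘ₗ g
  have hf : Function.Surjective f := by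
    refine N.mkQ_surjective.comp ?_
    rintro ⟨b, hb⟩
    have hb' := hb
    rw [← hm, Ideal.mem_span_range_iff_exists_fun] at hb'
    obtain ⟨c, hc⟩ := hb'
    exact ⟨c, Subtype.ext ((hg c).trans hc)⟩
  have hk : LinearMap.ker f = Submodule.pi Set.univ (fun _ : Fin k => (I : Submodule B B)) := by
    ext c
    have : c ∈ LinearMap.ker f ↔ ∑ i, c i * m i ∈ I ^ (n + 1) := by
      rw [← hg, LinearMap.mem_ker]
      exact Submodule.Quotient.mk_eq_zero N
    rw [this]
    simp only [Submodule.mem_pi, Set.mem_univ, true_imp_iff]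
    refine ⟨fun h => hq c h, fun h => Ideal.sum_mem _ fun i _ => ?_⟩
    rw [pow_succ']
    exact Ideal.mul_mem_mul (h i) (hmem i)
  let e : (↥(I ^ n) ⧸ N) ≃ₗ[B] (Fin k → B ⧸ I) :=
    (f.quotKerEquivOfSurjective hf).symm ≪≫ₗ Submodule.quotEquivOfEq _ _ hk ≪≫ₗ
      Submodule.quotientPi _
  have : Module.Flat R (Fin k → B ⧸ I) :=
    Module.Flat.of_linearEquiv
      (DFinsupp.linearEquivFunOnFintype (R := R) (M := fun _ : Fin k => B ⧸ I)).symm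
  exact Module.Flat.of_linearEquiv (e.restrictScalars R)

lemma lTensor_pow_injective (R R' : Type*) {B : Type*} [CommRing R] [CommRing R'] [CommRing B]
    [Algebra R B] [Algebra R R'] (I : Ideal B) [Module.Flat R (B ⧸ I)]
    (h : ∀ n, QuasiFreeAt I n) (n : ℕ) :
    Function.Injective
      (LinearMap.lTensor R' (Submodule.subtype (Submodule.restrictScalars R (I ^ n)))) := by
  induction n with
  | zero =>
    have hb : Function.Bijective (Submodule.subtype (Submodule.restrictScalars R (I ^ 0))) :=
      ⟨Subtype.val_injective, fun b => ⟨⟨b, by simp⟩, rfl⟩⟩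
    exact (LinearEquiv.lTensor R' (LinearEquiv.ofBijective _ hb)).injective
  | succ n ih =>
    have hle : Submodule.restrictScalars R (I ^ (n + 1)) ≤ Submodule.restrictScalars R (I ^ n) :=
      Ideal.pow_le_pow_right (Nat.le_succ n)
    have hc : Submodule.subtype (Submodule.restrictScalars R (I ^ (n + 1))) =
        Submodule.subtype (Submodule.restrictScalars R (I ^ n)) ∘ₗ Submodule.inclusion hle := rfl
    rw [hc, LinearMap.lTensor_comp]
    refine ih.comp ?_
    have := flat_pow_quotient R I n (h n)
    let N := Submodule.comap (Submodule.subtype (I ^ n)) (I ^ (n + 1))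
    let f : ↥(Submodule.restrictScalars R (I ^ n)) →ₗ[R] (↥(I ^ n) ⧸ N) :=
      N.mkQ.restrictScalars R
    refine LinearMap.lTensor_injective_of_exact_of_flat f N.mkQ_surjective
      (Submodule.inclusion hle) (Submodule.inclusion_injective hle) ?_ R'
    intro y
    have : f y = 0 ↔ (y : B) ∈ I ^ (n + 1) := Submodule.Quotient.mk_eq_zero N
    rw [this]
    constructor
    · intro hy; exact ⟨⟨y, hy⟩, rfl⟩
    · rintro ⟨z, rfl⟩; exact z.2

/-- Let `R → B` be a ring homomorphism, `I ⊂ B` an ideal generated by a regular sequence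
with `B/I` flat over `R`, and `R → R'` any ring homomorphism; set `B' = R' ⊗[R] B` and
`I' = I·B'`.  Then for every `n ≥ 0` the natural map `Iⁿ ⊗_R R' → B'` is injective with
image `(I')ⁿ`; this is the statement behind base change of blowing-ups along flat
regularly-embedded centers, giving `(⊕ₙ Iⁿ) ⊗_R R' ≅ ⊕ₙ (I')ⁿ`. -/
theorem baseChange_pow_injective_range_eq
    (R R' B : Type*) [CommRing R] [CommRing R'] [CommRing B]
    [Algebra R B] [Algebra R R']
    (r : ℕ) (x : Fin r → B)
    (hreg : RingTheory.Sequence.IsRegular B (List.ofFn x))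
    (I : Ideal B) (hI : I = Ideal.span (Set.range x))
    [Module.Flat R (B ⧸ I)] (n : ℕ) :
    Function.Injective (LinearMap.baseChange R' (Submodule.subtype (Submodule.restrictScalars R (I ^ n)))) ∧
    LinearMap.range (LinearMap.baseChange R' (Submodule.subtype (Submodule.restrictScalars R (I ^ n)))) =
      Submodule.restrictScalars R'
        ((Ideal.map (Algebra.TensorProduct.includeRight : B →ₐ[R] R' ⊗[R] B) I) ^ n) := by
  have hI' : I = Ideal.ofList (List.ofFn x) := by
    rw [hI, Ideal.ofList]
    congr 1
    ext b
    simp [List.mem_ofFn]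
  have hq : ∀ n, QuasiFreeAt I n := by
    rw [hI']
    exact quasiFreeAt_of_isWeaklyRegular _ hreg.toIsWeaklyRegular
  refine ⟨lTensor_pow_injective R R' I hq n, ?_⟩
  rw [← Ideal.map_pow]
  ext b
  exact (SetLike.ext_iff.mp (Ideal.map_includeRight_eq (A := R') (R := R) (I ^ n)) b).symm
end

section
/- Let A be artinian local with residue characteristic zero, (W → Spec A, E) an S-pair, C ⊂ W an irreducible permissible center with generic point y and defining ideal J = I(C), and I a never-zero W-ideal. Then 'I_y ⊆ (J_y)^b' holds if and only if 'Δ^{b−1}(I/S) ⊆ J' as sheaves of ideals, where Δ is the relative differential operator ideal: locally in the completion O^*_{W,x} ≅ A'[[x₁,…,xₙ]] (completion along an A-regular parameter system generating J_x), Δ(I/S) is generated by I and all first partials ∂f/∂xᵢ of f ∈ I, and Δ^{b−1} is the (b−1)-fold iterate. -/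
universe u

/-- The relative first derivative ideal `Δ(I/S)`: the ideal generated by `I` together
with all derivatives `D f` of elements `f ∈ I` by `A`-linear derivations of `B`.  For
`B` smooth over `A` with residue characteristic zero this agrees, in local completions
`A'[[x₁,…,xₙ]]`, with the ideal generated by `I` and all first partials `∂f/∂xᵢ`. -/
def deltaRel (A B : Type u) [CommRing A] [CommRing B] [Algebra A B] (I : Ideal B) :
    Ideal B :=
  I ⊔ Ideal.span {x : B | ∃ (D : Derivation A B B) (f : B), f ∈ I ∧ x = D f}

/-- The iterated relative derivative ideal `Δᵏ(I/S)`. -/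
def deltaRelIter (A B : Type u) [CommRing A] [CommRing B] [Algebra A B] (k : ℕ)
    (I : Ideal B) : Ideal B :=
  (deltaRel A B)^[k] I

open scoped TensorProduct

/-- Existence of a relative Euler derivation along a smooth center. -/
lemma exists_euler {A B : Type u} [CommRing A] [CommRing B] [Algebra A B]
    [Algebra.FormallySmooth A B] (J : Ideal B) [Algebra.FormallySmooth A (B ⧸ J)] :
    ∃ F : Derivation A B (J →₀ B), ∀ x ∈ J,
      Finsupp.linearCombination B (Subtype.val : J → B) (F x) - x ∈ J ^ 2 := by
  have hs : Function.Surjective (algebraMap B (B ⧸ J)) := Ideal.Quotient.mk_surjective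
  obtain ⟨l, hl⟩ := (Algebra.FormallySmooth.iff_split_injection (R := A) hs).mp inferInstance
  have hker : RingHom.ker (algebraMap B (B ⧸ J)) = J := Ideal.mk_ker
  let K := RingHom.ker (algebraMap B (B ⧸ J))
  let g : Ω[B⁄A] →ₗ[B] K.Cotangent := l ∘ₗ (TensorProduct.mk B (B ⧸ J) Ω[B⁄A] 1)
  let e : J → K := fun j => ⟨j, hker.ge j.2⟩
  let q : (J →₀ B) →ₗ[B] K.Cotangent := K.toCotangent ∘ₗ Finsupp.linearCombination B e
  have hq : Function.Surjective q := by
    intro y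
    obtain ⟨x, rfl⟩ := K.toCotangent_surjective y
    refine ⟨Finsupp.single ⟨x, hker.le x.2⟩ 1, ?_⟩
    simp [q, e]
  obtain ⟨h, hh⟩ := Module.projective_lifting_property q g hq
  refine ⟨h.compDer (KaehlerDifferential.D A B), fun x hx => ?_⟩
  have hxK : x ∈ K := hker.ge hx
  have h1 : q (h (KaehlerDifferential.D A B x)) = K.toCotangent ⟨x, hxK⟩ := by
    have h2 := LinearMap.congr_fun hl (K.toCotangent ⟨x, hxK⟩)
    have h3 := LinearMap.congr_fun hh (KaehlerDifferential.D A B x)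
    simp only [LinearMap.comp_apply] at h3
    rw [h3]
    have h6 := KaehlerDifferential.kerCotangentToTensor_toCotangent A B (B ⧸ J) ⟨x, hxK⟩
    rw [LinearMap.comp_apply] at h2
    exact (congrArg l h6).symm.trans h2
  have h4 := (K.toCotangent_eq).mp h1
  have h5 : K ^ 2 ≤ J ^ 2 := (congrArg (· ^ 2) hker).le
  replace h4 := h5 h4
  convert h4 using 2
  have : (Subtype.val : J → B) = K.subtype ∘ e := rfl
  rw [this, ← Finsupp.apply_linearCombination]
  rfl

lemma euler_pow {A B : Type u} [CommRing A] [CommRing B] [Algebra A B] (J : Ideal B)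
    (E : Derivation A B B) (hE0 : ∀ x, E x ∈ J) (hE : ∀ x ∈ J, E x - x ∈ J ^ 2) (c : ℕ) :
    ∀ y ∈ J ^ c, E y - (c : B) * y ∈ J ^ (c + 1) := by
  induction c with
  | zero => intro y _; simpa using hE0 y
  | succ c ih =>
    intro y hy
    rw [pow_succ'] at hy
    refine Submodule.mul_induction_on hy ?_ ?_
    · intro x hx z hz
      have : E (x * z) - ((c + 1 : ℕ) : B) * (x * z)
          = x * (E z - c * z) + z * (E x - x) := by
        rw [Derivation.leibniz]
        push_cast
        simp only [smul_eq_mul]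
        ring
      rw [this]
      refine add_mem ?_ ?_
      · rw [pow_succ']; exact Ideal.mul_mem_mul hx (ih z hz)
      · have := Ideal.mul_mem_mul hz (hE x hx)
        rwa [← pow_add] at this
    · intro x y hx hy
      have : E (x + y) - ((c + 1 : ℕ) : B) * (x + y) =
        (E x - ((c + 1 : ℕ) : B) * x) + (E y - ((c + 1 : ℕ) : B) * y) := by
        rw [map_add]; ring
      rw [this]
      exact add_mem hx hy

/-- If `g` and all its first derivatives lie in `J ^ c` then `g ∈ J ^ (c+1)`. -/
lemma mem_pow_succ_of_deriv {A B : Type u} [CommRing A] [CommRing B] [Algebra A B]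
    [Algebra.FormallySmooth A B] (J : Ideal B) [Algebra.FormallySmooth A (B ⧸ J)]
    (c : ℕ) (hc : IsUnit (c : B)) (g : B) (hg : g ∈ J ^ c)
    (hD : ∀ D : Derivation A B B, D g ∈ J ^ c) : g ∈ J ^ (c + 1) := by
  obtain ⟨F, hF⟩ := exists_euler (A := A) J
  let L : (J →₀ B) →ₗ[B] B := Finsupp.linearCombination B (Subtype.val : J → B)
  let E : Derivation A B B := L.compDer F
  have hE0 : ∀ x, E x ∈ J := by
    intro x
    change Finsupp.linearCombination B (Subtype.val : J → B) (F x) ∈ J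
    rw [Finsupp.linearCombination_apply]
    exact Submodule.sum_mem _ fun j _ => J.mul_mem_left _ j.2
  have h1 := euler_pow J E hE0 hF c g hg
  have h2 : E g ∈ J ^ (c + 1) := by
    change Finsupp.linearCombination B (Subtype.val : J → B) (F g) ∈ _
    rw [Finsupp.linearCombination_apply]
    refine Submodule.sum_mem _ fun j _ => ?_
    rw [pow_succ]
    exact Ideal.mul_mem_mul (hD ((Finsupp.lapply j : (J →₀ B) →ₗ[B] B).compDer F)) j.2
  have h3 : (c : B) * g ∈ J ^ (c + 1) := by
    have := sub_mem h2 h1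
    simpa using this
  exact (Ideal.unit_mul_mem_iff_mem _ hc).mp h3

lemma deltaIter_le_imp {A B : Type u} [CommRing A] [CommRing B] [Algebra A B]
    [Algebra.FormallySmooth A B] (J : Ideal B) [Algebra.FormallySmooth A (B ⧸ J)]
    (hu : ∀ c : ℕ, c ≠ 0 → IsUnit (c : B)) (k : ℕ) :
    ∀ I : Ideal B, deltaRelIter A B k I ≤ J → I ≤ J ^ (k + 1) := by
  induction k with
  | zero => intro I h; simpa [deltaRelIter] using h
  | succ k ih =>
    intro I h g hg
    have h1 : deltaRel A B I ≤ J ^ (k + 1) := ih _ h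
    refine mem_pow_succ_of_deriv (A := A) J (k + 1) (hu _ (by simp)) g
      (h1 (Ideal.mem_sup_left hg)) fun D => h1 (Ideal.mem_sup_right (Ideal.subset_span ⟨D, g, hg, rfl⟩))

lemma deriv_mem_pow {A B : Type u} [CommRing A] [CommRing B] [Algebra A B] (J : Ideal B)
    (D : Derivation A B B) (c : ℕ) : ∀ y ∈ J ^ (c + 1), D y ∈ J ^ c := by
  induction c with
  | zero => simp
  | succ c ih =>
    intro y hy
    rw [pow_succ'] at hy
    refine Submodule.mul_induction_on hy ?_ ?_
    · intro x hx z hz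
      rw [Derivation.leibniz]
      refine add_mem ?_ ?_
      · rw [smul_eq_mul, pow_succ']; exact Ideal.mul_mem_mul hx (ih z hz)
      · exact Ideal.mul_mem_right _ _ hz
    · intro x y hx hy
      rw [map_add]; exact add_mem hx hy

lemma deltaIter_le_of_le {A B : Type u} [CommRing A] [CommRing B] [Algebra A B] (J : Ideal B)
    (k : ℕ) : ∀ I : Ideal B, I ≤ J ^ (k + 1) → deltaRelIter A B k I ≤ J := by
  induction k with
  | zero => intro I h; simpa [deltaRelIter] using h
  | succ k ih =>
    intro I h
    refine ih (deltaRel A B I) (sup_le (h.trans (Ideal.pow_le_pow_right (by omega))) ?_)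
    rw [Ideal.span_le]
    rintro _ ⟨D, f, hf, rfl⟩
    exact deriv_mem_pow J D _ f (h hf)

lemma mem_pow_of_mul_mem_s13 {A B : Type u} [CommRing A] [CommRing B] [Algebra A B]
    [Algebra.FormallySmooth A B] (J : Ideal B) [Algebra.FormallySmooth A (B ⧸ J)]
    (hu : ∀ c : ℕ, c ≠ 0 → IsUnit (c : B)) (s : B) (hs : ∀ x, s * x ∈ J → x ∈ J) (c : ℕ) :
    ∀ g, s * g ∈ J ^ (c + 1) → g ∈ J ^ (c + 1) := by
  induction c with
  | zero => simpa using hs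
  | succ c ih =>
    intro g hg
    have h1 : g ∈ J ^ (c + 1) := ih g (Ideal.pow_le_pow_right (by omega) hg)
    refine mem_pow_succ_of_deriv (A := A) J (c + 1) (hu _ (by simp)) g h1 fun D => ih _ ?_
    have h2 := deriv_mem_pow J D _ _ hg
    rw [Derivation.leibniz, smul_eq_mul, smul_eq_mul] at h2
    simpa using sub_mem h2 (Ideal.mul_mem_right (D s) _ h1)

/-- Smooth algebras over a field of characteristic zero: no embedded torsion. -/
lemma field_case {k C : Type u} [Field k] [CharZero k] [CommRing C] [Algebra k C]
    [Algebra.Smooth k C] (s : C)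
    (h : ∀ (x : C) (n : ℕ), s ^ n * x = 0 → ∀ M : Ideal C, M.IsMaximal → x ∈ M)
    (x : C) (hx : s * x = 0) : x = 0 := by
  have : IsNoetherianRing C := Algebra.FiniteType.isNoetherianRing k C
  have hu : ∀ c : ℕ, c ≠ 0 → IsUnit (c : C) := fun c hc => by
    have : IsUnit (c : k) := by simpa using hc
    simpa using this.map (algebraMap k C)
  have key : ∀ M : Ideal C, M.IsMaximal → ∀ c : ℕ, ∀ (x : C) (n : ℕ), s ^ n * x = 0 →
      x ∈ M ^ (c + 1) := by
    intro M hM c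
    let _ : Field (C ⧸ M) := Ideal.Quotient.field M
    have : Algebra.FormallySmooth k (C ⧸ M) := inferInstance
    induction c with
    | zero => intro x n hx; simpa using h x n hx M hM
    | succ c ih =>
      intro x n hx
      refine mem_pow_succ_of_deriv (A := k) M (c + 1) (hu _ (by simp)) x (ih x n hx) fun D =>
        ih _ (n + n) ?_
      have h2 : s ^ n * D x + x * D (s ^ n) = 0 := by
        have := congrArg D hx
        simpa [Derivation.leibniz] using this
      calc s ^ (n + n) * D x = s ^ n * (s ^ n * D x + x * D (s ^ n)) - (s ^ n * x) * D (s ^ n) := by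
            ring
        _ = 0 := by rw [h2, hx]; ring
  by_contra hne
  have hann : Ideal.span {x} ≠ ⊥ := by simpa using hne
  let N : Ideal C := LinearMap.ker (LinearMap.toSpanSingleton C C x)
  have hN : N ≠ ⊤ := by
    intro hN
    have : (1 : C) ∈ N := hN ▸ Submodule.mem_top
    apply hne
    simpa [N] using this
  obtain ⟨M, hM, hNM⟩ := Ideal.exists_le_maximal N hN
  have hxM : x ∈ (⨅ i : ℕ, M ^ i • ⊤ : Submodule C C) := by
    rw [Submodule.mem_iInf]
    intro i
    have := key M hM i x 1 (by simpa using hx)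
    simpa using Ideal.pow_le_pow_right (Nat.le_succ i) this
  obtain ⟨r, hr⟩ := (Ideal.mem_iInf_smul_pow_eq_bot_iff M x).mp hxM
  have h1 : (1 - (r : C)) ∈ N := by
    have : (r : C) * x = x := hr
    simp [N, sub_mul, this]
  apply hM.ne_top
  rw [Ideal.eq_top_iff_one]
  simpa using add_mem (hNM h1) r.2

lemma flat_inj {A C : Type u} [CommRing A] [IsArtinianRing A] [IsLocalRing A]
    [CommRing C] [Algebra A C] [Module.Flat A C] (φ : C →ₗ[A] C)
    (h : Function.Injective (φ.lTensor (IsLocalRing.ResidueField A))) :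
    Function.Injective φ := by
  suffices H : Function.Injective (φ.lTensor A) by
    intro x y hxy
    have := @H ((1 : A) ⊗ₜ x) ((1 : A) ⊗ₜ y) (by simp [hxy])
    simpa using congrArg (TensorProduct.lid A C) this
  refine IsNoetherianRing.induction_on_isQuotientEquivQuotientPrime A
    (M := A) inferInstance
    (motive := fun N _ _ _ => Function.Injective (φ.lTensor N)) ?_ ?_ ?_
  · intro N _ _ _ _
    have : Subsingleton (N ⊗[A] C) := inferInstance
    exact Function.injective_of_subsingleton _
  · intro N _ _ _ p e
    have hp : p.1 = IsLocalRing.maximalIdeal A := IsLocalRing.eq_maximalIdeal inferInstance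
    let e' : N ≃ₗ[A] IsLocalRing.ResidueField A :=
      e.trans (Submodule.quotEquivOfEq _ _ hp)
    intro x y hxy
    apply (e'.rTensor C).injective
    apply h
    have hc : ∀ z, φ.lTensor (IsLocalRing.ResidueField A) (e'.rTensor C z)
        = e'.rTensor C (φ.lTensor N z) := by
      intro z
      induction z with
      | zero => simp
      | tmul a b => simp
      | add a b ha hb => simp only [map_add, ha, hb]
    rw [hc, hc, hxy]
  · intro N₁ _ _ _ N₂ _ _ _ N₃ _ _ _ f g hf hg hfg h1 h3
    have c1 : ∀ z, φ.lTensor N₂ (f.rTensor C z) = f.rTensor C (φ.lTensor N₁ z) := by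
      intro z
      rw [← LinearMap.comp_apply, ← LinearMap.comp_apply, LinearMap.lTensor_comp_rTensor,
        LinearMap.rTensor_comp_lTensor]
    have c2 : ∀ z, φ.lTensor N₃ (g.rTensor C z) = g.rTensor C (φ.lTensor N₂ z) := by
      intro z
      rw [← LinearMap.comp_apply, ← LinearMap.comp_apply, LinearMap.lTensor_comp_rTensor,
        LinearMap.rTensor_comp_lTensor]
    have hex := rTensor_exact C hfg hg
    have hfi := Module.Flat.rTensor_preserves_injective_linearMap (M := C) f hf
    rw [injective_iff_map_eq_zero]
    intro x hx
    have : g.rTensor C x = 0 := h3 (by rw [c2, hx, map_zero, map_zero])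
    obtain ⟨y, rfl⟩ := (hex x).mp this
    rw [c1] at hx
    have : y = 0 := h1 (hfi (by rw [hx]; simp))
    rw [this, map_zero]

lemma nzd {A C : Type u} [CommRing A] [IsArtinianRing A] [IsLocalRing A]
    [CharZero (IsLocalRing.ResidueField A)]
    [CommRing C] [Algebra A C] [Algebra.Smooth A C] (p : Ideal C) [p.IsPrime]
    (hp : ∀ q : Ideal C, q.IsPrime → p ≤ q) (s : C) (hs : s ∉ p) (x : C) (hx : s * x = 0) :
    x = 0 := by
  have hinj : Function.Injective (LinearMap.mulLeft A s) := by
    apply flat_inj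
    rw [injective_iff_map_eq_zero]
    intro z hz
    set k := IsLocalRing.ResidueField A
    have hz' : ((1 : k) ⊗ₜ[A] s) * z = 0 := by
      rw [← hz]
      clear hz
      induction z with
      | zero => simp
      | tmul a b => simp
      | add a b ha hb => simp only [mul_add, map_add, ha, hb]
    refine field_case (k := k) ((1 : k) ⊗ₜ[A] s) ?_ z hz'
    intro x n hxn M hM
    have hsurj : Function.Surjective (Algebra.TensorProduct.includeRight : C →ₐ[A] k ⊗[A] C) :=
      Algebra.TensorProduct.includeRight_surjective _ IsLocalRing.residue_surjective
    obtain ⟨y, rfl⟩ := hsurj x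
    have hker : Algebra.TensorProduct.includeRight (R := A) (A := k) (s ^ n * y) = 0 := by
      rw [map_mul, map_pow]; exact hxn
    have hmem : s ^ n * y ∈ p := by
      have hpA : p.comap (algebraMap A C) = IsLocalRing.maximalIdeal A :=
        IsLocalRing.eq_maximalIdeal inferInstance
      let g : k →ₐ[A] C ⧸ p := Ideal.Quotient.liftₐ (IsLocalRing.maximalIdeal A)
        (Algebra.ofId A (C ⧸ p)) (fun a ha => by
          have h1 : algebraMap A C a ∈ p := hpA.ge ha
          exact Ideal.Quotient.eq_zero_iff_mem.mpr h1)
      have h2 := congrArg (Algebra.TensorProduct.productMap g (Ideal.Quotient.mkₐ A p)) hker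
      rw [map_zero, Algebra.TensorProduct.includeRight_apply,
        Algebra.TensorProduct.productMap_apply_tmul, map_one, one_mul] at h2
      exact Ideal.Quotient.eq_zero_iff_mem.mp h2
    have hy : y ∈ p := ((‹p.IsPrime›.mem_or_mem hmem).resolve_left
      fun h => hs (‹p.IsPrime›.mem_of_pow_mem n h))
    exact hp (M.comap Algebra.TensorProduct.includeRight) (Ideal.comap_isPrime _ _) hy
  exact hinj (by simpa using hx)

/-- Let `A` be artinian local with residue characteristic zero, `W = Spec B` smooth over
`S = Spec A`, `C = V(J)` an irreducible permissible center (`J` is generated by an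
`A`-regular sequence with smooth quotient, and has a unique minimal prime `p`, the
generic point `y` of `C`), and `I` a never-zero `W`-ideal.  Then `I_y ⊆ (J_y)^b`
(i.e. `ν(I, C) ≥ b`, an inclusion in the local ring at the generic point) holds if and
only if `Δ^{b−1}(I/S) ⊆ J`. -/
theorem order_ge_iff_delta_le
    (A B : Type u) [CommRing A] [IsArtinianRing A] [IsLocalRing A]
    [CharZero (IsLocalRing.ResidueField A)]
    [CommRing B] [IsNoetherianRing B] [Algebra A B] [Algebra.Smooth A B]
    (I : Ideal B) (hInz : I ≠ ⊥) (b : ℕ) (hb : 0 < b)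
    (J : Ideal B)
    (hperm : ∃ (m : ℕ) (f : Fin m → B),
      RingTheory.Sequence.IsRegular B (List.ofFn f) ∧
      J = Ideal.span (Set.range f) ∧ Algebra.FormallySmooth A (B ⧸ J))
    (p : Ideal B) [p.IsPrime] (hp : p ∈ J.minimalPrimes)
    (hirr : J.minimalPrimes = {p}) :
    (Ideal.map (algebraMap B (Localization.AtPrime p)) I ≤
        (Ideal.map (algebraMap B (Localization.AtPrime p)) J) ^ b) ↔
      deltaRelIter A B (b - 1) I ≤ J := by
  obtain ⟨m, f, -, -, hfs⟩ := hperm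
  have hJp : J ≤ p := hp.1.2
  have hu : ∀ c : ℕ, c ≠ 0 → IsUnit (c : B) := fun c hc => by
    have h1 : IsUnit (IsLocalRing.residue A (c : A)) := by simpa using hc
    have h2 : IsUnit (c : A) := isUnit_of_map_unit (IsLocalRing.residue A) _ h1
    simpa using h2.map (algebraMap A B)
  obtain ⟨k, rfl⟩ : ∃ k, b = k + 1 := ⟨b - 1, by omega⟩
  rw [Nat.add_sub_cancel]
  constructor
  · intro h
    refine deltaIter_le_of_le J k I fun g hg => ?_
    have h1 := h (Ideal.mem_map_of_mem _ hg)
    rw [← Ideal.map_pow,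
      IsLocalization.algebraMap_mem_map_algebraMap_iff p.primeCompl] at h1
    obtain ⟨s, hs, hsg⟩ := h1
    have hfp : Algebra.FinitePresentation A (B ⧸ J) :=
      Algebra.FinitePresentation.of_finiteType.mp inferInstance
    have hsm : Algebra.Smooth A (B ⧸ J) := ⟨hfs, hfp⟩
    have hker : RingHom.ker (Ideal.Quotient.mk J) ≤ p := by rwa [Ideal.mk_ker]
    have hpr : (p.map (Ideal.Quotient.mk J)).IsPrime :=
      Ideal.map_isPrime_of_surjective Ideal.Quotient.mk_surjective hker
    refine mem_pow_of_mul_mem_s13 (A := A) J hu s (fun x hx => ?_) k g hsg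
    rw [← Ideal.Quotient.eq_zero_iff_mem]
    refine nzd (A := A) (p.map (Ideal.Quotient.mk J)) (fun q hq => ?_)
      (Ideal.Quotient.mk J s) (fun hmem => ?_) _ ?_
    · rw [Ideal.map_le_iff_le_comap]
      have hJq : J ≤ q.comap (Ideal.Quotient.mk J) := by
        intro z hz
        rw [Ideal.mem_comap, Ideal.Quotient.eq_zero_iff_mem.mpr hz]
        exact q.zero_mem
      obtain ⟨p', hp', hle⟩ := Ideal.exists_minimalPrimes_le hJq
      rw [hirr] at hp'
      rwa [Set.mem_singleton_iff.mp hp'] at hle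
    · have h2 : s ∈ (p.map (Ideal.Quotient.mk J)).comap (Ideal.Quotient.mk J) := hmem
      rw [Ideal.comap_map_of_surjective' _ Ideal.Quotient.mk_surjective, sup_eq_left.mpr hker] at h2
      exact hs h2
    · rw [← map_mul]
      exact Ideal.Quotient.eq_zero_iff_mem.mpr hx
  · intro h
    rw [← Ideal.map_pow]
    exact Ideal.map_mono (deltaIter_le_imp (A := A) J hu k I h)
end
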